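/- Let G be a basic 4-ac graph. If w is a point in the interior of an edge of |G|, then for any three further points x_0, x_1, x_2 of |G| there exists an arc in |G| that contains x_0, x_1 and x_2 and has w as an endpoint. -/

import Mathlib

open Topology

noncomputable section

variable {V : Type*}

open Classical in
/-- The Dirac function marking a vertex: the point of `|G|` corresponding to vertex `v`. -/
noncomputable def vertexPoint (v : V) : V → ℝ := fun u => if u = v then 1 else 0

open Classical in
/-- The point of `|G|` lying on the edge `vw` at parameter `t` (measured from `v` towards `w`). -/
noncomputable def edgePoint (v w : V) (t : ℝ) : V → ℝ :=
  fun u => (if u = v then 1 - t else 0) + (if u = w then t else 0)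

/-- The geometric realization `|G|` of a simple graph `G`, realized as the set of
formal convex combinations of adjacent pairs of vertices; each closed edge carries
its usual topology as a copy of `[0,1]`. -/
def GraphRealization (G : SimpleGraph V) : Set (V → ℝ) :=
  {x | (∃ v, x = vertexPoint v) ∨
    ∃ v w t, G.Adj v w ∧ t ∈ Set.Icc (0 : ℝ) 1 ∧ x = edgePoint v w t}

/-- A subset of a topological space is an arc if it is homeomorphic to `[0,1]`. -/
def IsArc {X : Type*} [TopologicalSpace X] (A : Set X) : Prop :=
  Nonempty (↥A ≃ₜ ↥unitInterval)

/-- A space is `n`-arc connected if any at most `n` points lie on a common arc. -/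
def NArcConn (X : Type*) [TopologicalSpace X] (n : ℕ) : Prop :=
  ∀ S : Finset X, S.card ≤ n → ∃ A : Set X, IsArc A ∧ ↑S ⊆ A

/-- The unit circle in the plane. -/
def unitCircleSet : Set (ℝ × ℝ) := {p | p.1 ^ 2 + p.2 ^ 2 = 1}

/-- A subset of a topological space is a simple closed curve if homeomorphic to the circle. -/
def IsSimpleClosedCurve {X : Type*} [TopologicalSpace X] (C : Set X) : Prop :=
  Nonempty (↥C ≃ₜ ↥unitCircleSet)

/-- A space is `n`-circle connected if any at most `n` points lie on a common
simple closed curve. -/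
def NCircleConn (X : Type*) [TopologicalSpace X] (n : ℕ) : Prop :=
  ∀ S : Finset X, S.card ≤ n → ∃ C : Set X, IsSimpleClosedCurve C ∧ ↑S ⊆ C

/-- A space is `n`-strongly arc connected if any list of at most `n` points is contained
in an arc, the points appearing along the arc in the listed order. -/
def NStrongArcConn (X : Type*) [TopologicalSpace X] (n : ℕ) : Prop :=
  ∀ l : List X, l.length ≤ n →
    ∃ f : ↥unitInterval → X, Topology.IsEmbedding f ∧
      ∃ t : Fin l.length → ↥unitInterval, Monotone t ∧ ∀ i, f (t i) = l.get i

/-- A graph is `k`-connected if removing fewer than `k` vertices leaves it connected. -/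
def KConnected (G : SimpleGraph V) (k : ℕ) : Prop :=
  ∀ S : Set V, S.encard < (k : ℕ∞) → (G.induce (Sᶜ : Set V)).Connected

/-- A graph is cyclically connected if any two vertices lie on a common cycle. -/
def CyclicallyConnected (G : SimpleGraph V) : Prop :=
  ∀ v w : V, ∃ (u : V) (c : G.Walk u u), c.IsCycle ∧ v ∈ c.support ∧ w ∈ c.support

/-- The circle of radius `r` centered at `c` in the plane. -/
def circleAt (c : ℝ × ℝ) (r : ℝ) : Set (ℝ × ℝ) :=
  {p | (p.1 - c.1) ^ 2 + (p.2 - c.2) ^ 2 = r ^ 2}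

/-- The horizontal segment at height `y` from abscissa `a` to `b`. -/
def hSeg (y a b : ℝ) : Set (ℝ × ℝ) := {p | p.2 = y ∧ a ≤ p.1 ∧ p.1 ≤ b}

/-- The θ-curve: unit circle together with horizontal diameter. -/
def thetaSet : Set (ℝ × ℝ) := circleAt (0, 0) 1 ∪ hSeg 0 (-1) 1

/-- Figure-eight: two unit circles meeting at the origin. -/
def figureEightSet : Set (ℝ × ℝ) := circleAt (-1, 0) 1 ∪ circleAt (1, 0) 1

/-- Lollipop: unit circle with the segment from `(1,0)` to `(2,0)` attached. -/
def lollipopSet : Set (ℝ × ℝ) := circleAt (0, 0) 1 ∪ hSeg 0 1 2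

/-- Lollipop with its free endpoint removed. -/
def openLollipopSet : Set (ℝ × ℝ) := lollipopSet \ {(2, 0)}

/-- Dumbbell: two disjoint unit circles joined by a segment. -/
def dumbbellSet : Set (ℝ × ℝ) := circleAt (-2, 0) 1 ∪ circleAt (2, 0) 1 ∪ hSeg 0 (-1) 1

/-- Happy-face curve: two circles meeting at a point, joined by a further arc. -/
def happyFaceSet : Set (ℝ × ℝ) :=
  circleAt (-1, 0) 1 ∪ circleAt (1, 0) 1 ∪ {p | p.1 ^ 2 + p.2 ^ 2 = 4 ∧ p.2 ≤ 0}

/-- Baguette curve: two disjoint circles joined by two disjoint arcs. -/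
def baguetteSet : Set (ℝ × ℝ) :=
  circleAt (-3, 0) 1 ∪ circleAt (3, 0) 1 ∪ hSeg 0 (-2) 2 ∪ hSeg 1 (-3) 3

/-- A graph is a basic 4-ac graph iff its realization is homeomorphic to a circle,
a θ-curve, a happy-face curve or a baguette curve (this captures precisely the
subdivisions of those four graphs). -/
def IsBasicFourAC {W : Type*} (H : SimpleGraph W) : Prop :=
  Nonempty (↥(GraphRealization H) ≃ₜ ↥unitCircleSet) ∨
  Nonempty (↥(GraphRealization H) ≃ₜ ↥thetaSet) ∨
  Nonempty (↥(GraphRealization H) ≃ₜ ↥happyFaceSet) ∨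
  Nonempty (↥(GraphRealization H) ≃ₜ ↥baguetteSet)

/-- A chain-graph decomposition of the connected graph `G`: links indexed by an
interval `J` of `ℤ`, non-consecutive links are disjoint, consecutive links share
exactly one vertex. -/
structure IsChainGraph (G : SimpleGraph V) (J : Set ℤ) (L : ℤ → G.Subgraph) : Prop where
  connected : G.Connected
  ordConnected : J.OrdConnected
  nonempty : J.Nonempty
  cover : (⨆ i ∈ J, L i) = (⊤ : G.Subgraph)
  sep : ∀ i ∈ J, ∀ j ∈ J, i + 1 < j → (L i).verts ∩ (L j).verts = ∅
  link : ∀ i ∈ J, i + 1 ∈ J → ∃ v, (L i).verts ∩ (L (i + 1)).verts = {v}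

/-- A cut-vertex: a vertex whose removal disconnects the graph. -/
def IsCutVertex (G : SimpleGraph V) (v : V) : Prop :=
  ¬ (G.induce ({v}ᶜ : Set V)).Connected

/-- A block: a maximal 2-connected subgraph. -/
def IsBlock (G : SimpleGraph V) (H : G.Subgraph) : Prop :=
  KConnected H.coe 2 ∧ ∀ H' : G.Subgraph, H ≤ H' → KConnected H'.coe 2 → H' = H

/-- The block graph of `G`: the bipartite graph on cut-vertices and blocks, a cut-vertex
being adjacent to the blocks containing it. -/
def BlockGraph (G : SimpleGraph V) :
    SimpleGraph ({v : V // IsCutVertex G v} ⊕ {H : G.Subgraph // IsBlock G H}) :=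
  SimpleGraph.fromRel fun a b =>
    ∃ (c : {v : V // IsCutVertex G v}) (B : {H : G.Subgraph // IsBlock G H}),
      a = Sum.inl c ∧ b = Sum.inr B ∧ (c : V) ∈ (B : G.Subgraph).verts

/-- An `A`–`B` path: a path starting in `A`, ending in `B` and meeting `A ∪ B` only
in these two endvertices. -/
structure ABPath (G : SimpleGraph V) (A B : Set V) where
  first : V
  last : V
  walk : G.Walk first last
  isPath : walk.IsPath
  firstA : first ∈ A
  lastB : last ∈ B
  meetA : ∀ v ∈ walk.support, v ∈ A → v = first
  meetB : ∀ v ∈ walk.support, v ∈ B → v = last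

/-- A family of pairwise vertex-disjoint paths. -/
def PathFamilyDisjoint {G : SimpleGraph V} {A B : Set V} {k : ℕ}
    (P : Fin k → ABPath G A B) : Prop :=
  ∀ i j, i ≠ j → ∀ v, v ∈ (P i).walk.support → v ∉ (P j).walk.support

/-- The set of vertices used by a family of paths. -/
def familySupport {G : SimpleGraph V} {A B : Set V} {k : ℕ}
    (P : Fin k → ABPath G A B) : Set V :=
  {v | ∃ i, v ∈ (P i).walk.support}

/-- The set of edges used by a family of paths. -/
def familyEdges {G : SimpleGraph V} {A B : Set V} {k : ℕ}
    (P : Fin k → ABPath G A B) : Set (Sym2 V) :=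
  {e | ∃ i, e ∈ (P i).walk.edges}

/-- A walk `W` (with no repeated edges) is alternating with respect to the disjoint
path family `P`: it starts in `A` off the paths; repeated vertices lie on paths of the
family; upon hitting a path by a new edge it follows that path backwards for at least
one edge; and it traverses edges of paths of the family only backwards. -/
structure IsAlternatingWalk {G : SimpleGraph V} {A B : Set V} {k : ℕ}
    (P : Fin k → ABPath G A B) {x y : V} (W : G.Walk x y) : Prop where
  trail : W.IsTrail
  startA : x ∈ A
  startOff : x ∉ familySupport P
  repeats : ∀ v, List.Duplicate v W.support → v ∈ familySupport P
  follows : ∀ (i : ℕ) (hi : i < W.darts.length) (j : Fin k),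
      (W.darts.get ⟨i, hi⟩).snd ∈ (P j).walk.support →
      (W.darts.get ⟨i, hi⟩).edge ∉ (P j).walk.edges →
      ∃ h : i + 1 < W.darts.length, (W.darts.get ⟨i + 1, h⟩).symm ∈ (P j).walk.darts
  backward : ∀ d ∈ W.darts, ∀ j : Fin k,
      d.edge ∈ (P j).walk.edges → d.symm ∈ (P j).walk.darts

end


/-- `S` is an arc with endpoints `x` and `y`. -/
def IsArcFromTo {Y : Type*} [TopologicalSpace Y] (x y : Y) (S : Set Y) : Prop :=
  ∃ γ : Path x y, Function.Injective γ ∧ Set.range γ = S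

namespace IsArcFromTo

variable {Y : Type*} [TopologicalSpace Y] {x y z : Y} {S T : Set Y}

theorem left_mem (h : IsArcFromTo x y S) : x ∈ S := by
  obtain ⟨γ, -, rfl⟩ := h
  exact ⟨0, γ.source⟩

theorem right_mem (h : IsArcFromTo x y S) : y ∈ S := by
  obtain ⟨γ, -, rfl⟩ := h
  exact ⟨1, γ.target⟩

theorem symm (h : IsArcFromTo x y S) : IsArcFromTo y x S := by
  obtain ⟨γ, hi, rfl⟩ := h
  exact ⟨γ.symm, hi.comp unitInterval.symm_bijective.injective, γ.symm_range⟩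

theorem trans (h : IsArcFromTo x y S) (h' : IsArcFromTo y z T) (hST : ∀ p ∈ S, p ∈ T → p = y) :
    IsArcFromTo x z (S ∪ T) := by
  obtain ⟨γ, hi, rfl⟩ := h
  obtain ⟨δ, hj, rfl⟩ := h'
  refine ⟨γ.trans δ, ?_, γ.trans_range δ⟩
  have key : ∀ s t : unitInterval, (s : ℝ) ≤ 1 / 2 → ¬ (t : ℝ) ≤ 1 / 2 →
      γ.trans δ s ≠ γ.trans δ t := by
    intro s t hs ht hst
    rw [Path.trans_apply, Path.trans_apply, dif_pos hs, dif_neg ht] at hst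
    have h2 := hST _ ⟨_, rfl⟩ ⟨_, hst.symm⟩
    rw [hst] at h2
    have h3 := congrArg Subtype.val (hj (h2.trans δ.source.symm))
    simp only [Set.Icc.coe_zero] at h3
    linarith
  intro s t hst
  by_cases hs : (s : ℝ) ≤ 1 / 2 <;> by_cases ht : (t : ℝ) ≤ 1 / 2
  · rw [Path.trans_apply, Path.trans_apply, dif_pos hs, dif_pos ht] at hst
    have h3 := congrArg Subtype.val (hi hst)
    simp only at h3
    exact Subtype.ext (by linarith)
  · exact absurd hst (key s t hs ht)
  · exact absurd hst.symm (key t s ht hs)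
  · rw [Path.trans_apply, Path.trans_apply, dif_neg hs, dif_neg ht] at hst
    have h3 := congrArg Subtype.val (hj hst)
    simp only at h3
    exact Subtype.ext (by linarith)

/-- The initial piece of an injective path. -/
theorem of_path_initial (γ : Path x y) (hi : Function.Injective γ) (s : unitInterval)
    (hs : 0 < s) : IsArcFromTo x (γ s) (γ '' Set.Iic s) := by
  have hs' : (0 : ℝ) < s := hs
  refine ⟨⟨⟨fun t => γ (s * t), by fun_prop⟩, by simp, by simp⟩, ?_, ?_⟩
  · intro a b hab
    have := congrArg Subtype.val (hi hab)
    simp only [Set.Icc.coe_mul] at this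
    exact Subtype.ext (mul_left_cancel₀ hs'.ne' this)
  · ext p
    constructor
    · rintro ⟨t, rfl⟩
      exact ⟨s * t, unitInterval.mul_le_left, rfl⟩
    · rintro ⟨t, ht, rfl⟩
      have ht' : (t : ℝ) ≤ s := ht
      refine ⟨⟨t / s, div_nonneg t.2.1 hs'.le, (div_le_one hs').2 ht'⟩, ?_⟩
      change γ _ = γ t
      congr 1
      exact Subtype.ext (mul_div_cancel₀ _ hs'.ne')

/-- An interior point divides an arc into two arcs. -/
theorem exists_split (h : IsArcFromTo x y S) (hz : z ∈ S) (hx : z ≠ x) (hy : z ≠ y) :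
    ∃ S₁ S₂, IsArcFromTo x z S₁ ∧ IsArcFromTo z y S₂ ∧ S₁ ∪ S₂ = S ∧
      ∀ p ∈ S₁, p ∈ S₂ → p = z := by
  obtain ⟨γ, hi, rfl⟩ := h
  obtain ⟨s, rfl⟩ := hz
  have h0 : 0 < s := unitInterval.pos_iff_ne_zero.2 (by rintro rfl; simp at hx)
  have h1 : s < 1 := unitInterval.lt_one_iff_ne_one.2 (by rintro rfl; simp at hy)
  have hb := of_path_initial γ.symm (hi.comp unitInterval.symm_bijective.injective)
    (unitInterval.symm s) (by
      rw [unitInterval.pos_iff_ne_zero]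
      intro h
      exact h1.ne (by rw [← unitInterval.symm_symm s, h, unitInterval.symm_zero]))
  have hb' : IsArcFromTo (γ s) y (γ '' Set.Ici s) := by
    convert hb.symm using 1
    · simp
    · ext p
      constructor
      · rintro ⟨t, ht, rfl⟩
        refine ⟨unitInterval.symm t, ?_, by simp⟩
        have ht' : (s : ℝ) ≤ t := ht
        change (1 - (t : ℝ)) ≤ 1 - s
        linarith
      · rintro ⟨t, ht, rfl⟩
        refine ⟨unitInterval.symm t, ?_, rfl⟩
        have ht' : (t : ℝ) ≤ 1 - s := ht
        change (s : ℝ) ≤ 1 - t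
        linarith
  refine ⟨_, _, of_path_initial γ hi s h0, hb', ?_, ?_⟩
  · rw [← Set.image_union, Set.Iic_union_Ici, Set.image_univ]
  · rintro _ ⟨t, ht, rfl⟩ ⟨r, hr, hrt⟩
    have := hi hrt
    subst this
    rw [le_antisymm (Set.mem_Iic.1 ht) (Set.mem_Ici.1 hr)]

/-- An arc can be shortened slightly so as to avoid its final endpoint while keeping
finitely many prescribed points. -/
theorem exists_shorten (h : IsArcFromTo x y S) (F : Finset Y) :
    ∃ y' S', IsArcFromTo x y' S' ∧ S' ⊆ S ∧ y ∉ S' ∧ ∀ p ∈ F, p ∈ S → p ≠ y → p ∈ S' := by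
  obtain ⟨γ, hi, rfl⟩ := h
  have key : ∃ s : unitInterval, 0 < s ∧ s < 1 ∧
      ∀ p ∈ F, p ∈ Set.range γ → p ≠ y → p ∈ γ '' Set.Iic s := by
    classical
    induction F using Finset.induction_on with
    | empty => exact ⟨⟨1 / 2, by norm_num, by norm_num⟩, by
        rw [← Subtype.coe_lt_coe]; norm_num, by rw [← Subtype.coe_lt_coe]; norm_num, by simp⟩
    | insert a F _ ih =>
      obtain ⟨s, h0, h1, hs⟩ := ih
      by_cases ha : a ∈ Set.range γ ∧ a ≠ y
      · obtain ⟨⟨t, rfl⟩, hy⟩ := ha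
        have ht : t < 1 := unitInterval.lt_one_iff_ne_one.2 (by rintro rfl; simp at hy)
        refine ⟨max s t, lt_max_of_lt_left h0, max_lt h1 ht, ?_⟩
        intro p hp hpr hpy
        rcases Finset.mem_insert.1 hp with rfl | hp
        · exact ⟨t, Set.mem_Iic.2 (le_max_right _ _), rfl⟩
        · obtain ⟨r, hr, rfl⟩ := hs p hp hpr hpy
          exact ⟨r, Set.mem_Iic.2 (le_max_of_le_left hr), rfl⟩
      · refine ⟨s, h0, h1, ?_⟩
        intro p hp hpr hpy
        rcases Finset.mem_insert.1 hp with rfl | hp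
        · exact absurd ⟨hpr, hpy⟩ ha
        · exact hs p hp hpr hpy
  obtain ⟨s, h0, h1, hs⟩ := key
  refine ⟨_, _, of_path_initial γ hi s h0, Set.image_subset_range _ _, ?_, hs⟩
  rintro ⟨t, ht, hty⟩
  have : t = 1 := hi (hty.trans γ.target.symm)
  subst this
  exact absurd ht (not_le.2 h1)

/-- Pulling an arc back along an embedding whose range contains it. -/
theorem preimage {Z : Type*} [TopologicalSpace Z] {h : Y → Z} (hh : IsEmbedding h) {x y : Y}
    {S : Set Z} (hS : IsArcFromTo (h x) (h y) S) (hr : S ⊆ Set.range h) :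
    IsArcFromTo x y (h ⁻¹' S) := by
  obtain ⟨γ, hi, rfl⟩ := hS
  choose g hg using fun t => hr ⟨t, rfl⟩
  have hg' : h ∘ g = γ := funext hg
  refine ⟨⟨⟨g, ?_⟩, ?_, ?_⟩, ?_, ?_⟩
  · rw [hh.continuous_iff, hg']
    exact γ.continuous
  · exact hh.injective (by rw [hg, γ.source])
  · exact hh.injective (by rw [hg, γ.target])
  · intro a b hab
    apply hi
    rw [← hg, ← hg]
    exact congrArg h hab
  · ext p
    constructor
    · rintro ⟨t, rfl⟩
      exact ⟨t, (hg t).symm⟩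
    · rintro ⟨t, ht⟩
      exact ⟨t, hh.injective (by rw [← ht]; exact hg t)⟩

/-- Near its initial point, where the space is embedded in the line by `φ`, an arc fills up
one side of that point. -/
theorem exists_side (h : IsArcFromTo x y S) {φ : Y → ℝ} {U : Set Y} (hU : U ∈ 𝓝 x)
    (hc : ContinuousOn φ U) (hinj : Set.InjOn φ U) :
    ∃ b : Bool, ∃ δ > 0, ∀ r ∈ Set.Ioo (0 : ℝ) δ,
      ∃ z ∈ S, z ≠ x ∧ z ≠ y ∧ z ∈ U ∧ φ z = φ x + (if b then r else -r) := by
  obtain ⟨γ, hi, rfl⟩ := h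
  have h1 : γ.extend ⁻¹' U ∈ 𝓝 (0 : ℝ) :=
    γ.continuous_extend.continuousAt.preimage_mem_nhds (by simpa using hU)
  obtain ⟨ε, hε, hεU⟩ := Metric.mem_nhds_iff.1 h1
  obtain ⟨e, he0, he1, heε⟩ : ∃ e : ℝ, 0 < e ∧ e < 1 ∧ e < ε :=
    ⟨min (1 / 2) (ε / 2), by positivity, (min_le_left _ _).trans_lt (by norm_num),
      (min_le_right _ _).trans_lt (by linarith)⟩
  have hmem : ∀ t ∈ Set.Icc 0 e, γ.extend t ∈ U := by
    intro t ht
    apply hεU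
    rw [Metric.mem_ball, Real.dist_0_eq_abs, abs_of_nonneg ht.1]
    exact ht.2.trans_lt heε
  have hcont : ContinuousOn (fun t => φ (γ.extend t)) (Set.Icc 0 e) :=
    hc.comp γ.continuous_extend.continuousOn hmem
  have hpt : ∀ t ∈ Set.Icc 0 e, t ≠ 0 → γ.extend t ∈ Set.range γ ∧ γ.extend t ≠ x ∧
      γ.extend t ≠ y := by
    intro t ht h0
    have htI : t ∈ unitInterval := ⟨ht.1, ht.2.trans he1.le⟩
    rw [γ.extend_apply htI]
    refine ⟨⟨_, rfl⟩, fun h => h0 ?_, fun h => ?_⟩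
    · exact congrArg Subtype.val (hi (h.trans γ.source.symm))
    · have h2 : t = 1 := congrArg Subtype.val (hi (h.trans γ.target.symm))
      have := ht.2
      linarith
  have hne : φ (γ.extend e) ≠ φ x := fun h =>
    (hpt e ⟨he0.le, le_rfl⟩ he0.ne').2.1
      (hinj (hmem e ⟨he0.le, le_rfl⟩) (mem_of_mem_nhds hU) h)
  have hivt := intermediate_value_uIcc (a := 0) (b := e) (f := fun t => φ (γ.extend t))
    (by rwa [Set.uIcc_of_le he0.le])
  simp only [Path.extend_zero, Set.uIcc_of_le he0.le] at hivt
  have conc : ∀ r : ℝ, r ≠ 0 → φ x + r ∈ Set.uIcc (φ x) (φ (γ.extend e)) →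
      ∃ z ∈ Set.range γ, z ≠ x ∧ z ≠ y ∧ z ∈ U ∧ φ z = φ x + r := by
    intro r hr hm
    obtain ⟨t, ht, hrt⟩ := hivt hm
    simp only at hrt
    have h0 : t ≠ 0 := by
      rintro rfl
      rw [γ.extend_zero] at hrt
      exact hr (by linarith)
    obtain ⟨ha, hb, hc⟩ := hpt t ht h0
    exact ⟨_, ha, hb, hc, hmem t ht, hrt⟩
  rcases hne.lt_or_gt with hlt | hlt
  · refine ⟨false, φ x - φ (γ.extend e), by linarith, fun r hr => ?_⟩
    obtain ⟨hr0, hr1⟩ := hr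
    refine conc _ (by simpa using hr0.ne') ?_
    rw [Set.uIcc_of_ge hlt.le]
    constructor <;> simp <;> linarith
  · refine ⟨true, φ (γ.extend e) - φ x, by linarith, fun r hr => ?_⟩
    obtain ⟨hr0, hr1⟩ := hr
    refine conc _ (by simpa using hr0.ne') ?_
    rw [Set.uIcc_of_le hlt.le]
    constructor <;> simp <;> linarith

/-- A point with a neighbourhood embeddable in the line is not the common endpoint of three
arcs which are pairwise disjoint up to endpoints. -/
theorem exists_inter_of_three {f : Fin 3 → Y} {A : Fin 3 → Set Y}
    (h : ∀ i, IsArcFromTo x (f i) (A i)) {φ : Y → ℝ} {U : Set Y} (hU : U ∈ 𝓝 x)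
    (hc : ContinuousOn φ U) (hinj : Set.InjOn φ U) :
    ∃ i j, i ≠ j ∧ ∃ z ∈ A i, z ∈ A j ∧ z ≠ x ∧ z ≠ f i := by
  choose b δ hδ hb using fun i => (h i).exists_side hU hc hinj
  obtain ⟨i, j, hij, hbij⟩ := Fintype.exists_ne_map_eq_of_card_lt b (by simp)
  have hm : 0 < min (δ i) (δ j) := lt_min (hδ i) (hδ j)
  obtain ⟨z, hz, hzx, hzf, hzU, hzφ⟩ := hb i (min (δ i) (δ j) / 2)
    ⟨by linarith, by linarith [min_le_left (δ i) (δ j)]⟩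
  obtain ⟨z', hz', -, -, hzU', hzφ'⟩ := hb j (min (δ i) (δ j) / 2)
    ⟨by linarith, by linarith [min_le_right (δ i) (δ j)]⟩
  have : z = z' := hinj hzU hzU' (by rw [hzφ, hzφ', hbij])
  subst this
  exact ⟨i, j, hij, z, hz, hz', hzx, hzf⟩

/-- The graph of a continuous function on a compact interval is an arc. -/
theorem of_graph {a b : ℝ} (hab : a < b) {f : ℝ → ℝ} (hf : Continuous f) :
    IsArcFromTo (a, f a) (b, f b) {p : ℝ × ℝ | a ≤ p.1 ∧ p.1 ≤ b ∧ p.2 = f p.1} := by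
  refine ⟨⟨⟨fun t => (a + t * (b - a), f (a + t * (b - a))), by fun_prop⟩, by simp, by simp⟩,
    ?_, ?_⟩
  · intro s t hst
    have h1 : a + (s : ℝ) * (b - a) = a + t * (b - a) := congrArg Prod.fst hst
    exact Subtype.ext (mul_right_cancel₀ (sub_pos.2 hab).ne' (by linarith))
  · ext ⟨p, q⟩
    constructor
    · rintro ⟨t, ht⟩
      obtain ⟨rfl, rfl⟩ := Prod.mk.inj ht
      refine ⟨?_, ?_, rfl⟩
      · nlinarith [t.2.1]
      · change a + (t : ℝ) * (b - a) ≤ b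
        nlinarith [t.2.2]
    · rintro ⟨h1, h2, h3⟩
      simp only at h1 h2 h3
      subst h3
      have hp : a + (p - a) / (b - a) * (b - a) = p := by
        rw [div_mul_cancel₀ _ (sub_pos.2 hab).ne']; ring
      refine ⟨⟨(p - a) / (b - a), div_nonneg (by linarith) (by linarith),
        (div_le_one (by linarith)).2 (by linarith)⟩, ?_⟩
      change (a + (p - a) / (b - a) * (b - a), f (a + (p - a) / (b - a) * (b - a))) = (p, f p)
      rw [hp]

end IsArcFromTo

/-- An edge of a finite multigraph, given by a label and two endpoints. -/
abbrev LabelledEdge := ℕ × ℕ × ℕ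

/-- The edge sets of walks extending a given path which end upon returning to a visited
vertex. -/
def lassos (es : List LabelledEdge) :
    ℕ → ℕ → List ℕ → List LabelledEdge → List (List LabelledEdge)
  | 0, _, _, _ => []
  | n + 1, cur, vis, used => es.flatMap fun e =>
      if e ∈ used then [] else
        (if e.2.1 = cur then
          (if e.2.2 ∈ vis then [e :: used] else lassos es n e.2.2 (e.2.2 :: vis) (e :: used))
          else []) ++
        (if e.2.2 = cur then
          (if e.2.1 ∈ vis then [e :: used] else lassos es n e.2.1 (e.2.1 :: vis) (e :: used))
          else [])

/-- Any three edges lie on a lasso starting at `v`. -/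
def LassoConn (es : List LabelledEdge) (v : ℕ) : Prop :=
  ∀ e₀ ∈ es, ∀ e₁ ∈ es, ∀ e₂ ∈ es, ∃ L ∈ lassos es 10 v [v] [], e₀ ∈ L ∧ e₁ ∈ L ∧ e₂ ∈ L

instance (es : List LabelledEdge) (v : ℕ) : Decidable (LassoConn es v) := by
  unfold LassoConn; infer_instance

/-- Subdivision of an edge by a new vertex. -/
def subdivideEdge (es : List LabelledEdge) (e : LabelledEdge) : List LabelledEdge :=
  (100, e.2.1, 100) :: (101, 100, e.2.2) :: es.filter (· ≠ e)

/-- Three distinct edges are incident with `c`. -/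
def IsBranch (es : List LabelledEdge) (c : ℕ) : Prop :=
  ∃ e₀ ∈ es, ∃ e₁ ∈ es, ∃ e₂ ∈ es, e₀ ≠ e₁ ∧ e₀ ≠ e₂ ∧ e₁ ≠ e₂ ∧
    (c = e₀.2.1 ∨ c = e₀.2.2) ∧ (c = e₁.2.1 ∨ c = e₁.2.2) ∧ (c = e₂.2.1 ∨ c = e₂.2.2)

instance (es : List LabelledEdge) (c : ℕ) : Decidable (IsBranch es c) := by
  unfold IsBranch; infer_instance

/-- The finite check on a multigraph which provides an arc from an interior point of an edge, or
from a vertex that is not a branch vertex, through any three points. -/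
structure Admissible (es : List LabelledEdge) : Prop where
  lt : ∀ e ∈ es, e.1 < 100 ∧ e.2.1 < 100 ∧ e.2.2 < 100
  edge : ∀ e ∈ es, LassoConn (subdivideEdge es e) 100
  src : ∀ e ∈ es, IsBranch es e.2.1 ∨ LassoConn es e.2.1
  tgt : ∀ e ∈ es, IsBranch es e.2.2 ∨ LassoConn es e.2.2

/-- A realization of the multigraph `es` as a subset `X` of a topological space. -/
structure Realizes {Y : Type*} [TopologicalSpace Y] (es : List LabelledEdge) (pt : ℕ → Y)
    (arc : LabelledEdge → Set Y) (X : Set Y) : Prop where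
  isArc : ∀ e ∈ es, IsArcFromTo (pt e.2.1) (pt e.2.2) (arc e)
  inter : ∀ e ∈ es, ∀ e' ∈ es, e ≠ e' → ∀ z ∈ arc e, z ∈ arc e' →
    ∃ c, (c = e.2.1 ∨ c = e.2.2) ∧ (c = e'.2.1 ∨ c = e'.2.2) ∧ z = pt c
  cover : ∀ z, z ∈ X ↔ ∃ e ∈ es, z ∈ arc e

/-- `S` is the arc swept out by a path from `w` to the vertex `cur` with edges `used` and
vertices `vis`. -/
structure IsSweptPath {Y : Type*} [TopologicalSpace Y] (es : List LabelledEdge) (pt : ℕ → Y)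
    (arc : LabelledEdge → Set Y) (w : Y) (cur : ℕ) (vis : List ℕ) (used : List LabelledEdge)
    (S : Set Y) : Prop where
  isArc : (w = pt cur ∧ S = {w}) ∨ IsArcFromTo w (pt cur) S
  used_mem : ∀ e ∈ used, e ∈ es
  arc_subset : ∀ e ∈ used, arc e ⊆ S
  mem_imp : ∀ z ∈ S, z = pt cur ∨ ∃ e ∈ used, z ∈ arc e
  ends_mem : ∀ e ∈ used, e.2.1 ∈ vis ∧ e.2.2 ∈ vis
  pt_mem : ∀ c ∈ vis, pt c ∈ S
  cur_mem : cur ∈ vis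

namespace IsSweptPath

variable {Y : Type*} [TopologicalSpace Y] {es : List LabelledEdge} {pt : ℕ → Y}
  {arc : LabelledEdge → Set Y} {X : Set Y} {w : Y} {cur d : ℕ} {vis : List ℕ}
  {used : List LabelledEdge} {S : Set Y} {e : LabelledEdge}

theorem trans (P : IsSweptPath es pt arc w cur vis used S) {y : Y} {T : Set Y}
    (hT : IsArcFromTo (pt cur) y T) (hST : ∀ p ∈ S, p ∈ T → p = pt cur) :
    IsArcFromTo w y (S ∪ T) := by
  rcases P.isArc with ⟨rfl, rfl⟩ | h
  · rwa [Set.union_eq_self_of_subset_left (Set.singleton_subset_iff.2 hT.left_mem)]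
  · exact h.trans hT hST

theorem inter_arc (R : Realizes es pt arc X) (P : IsSweptPath es pt arc w cur vis used S)
    (he : e ∈ es) (hu : e ∉ used) (hends : ∀ c, (c = e.2.1 ∨ c = e.2.2) → c = cur ∨ c = d)
    {z : Y} (hz : z ∈ S) (hze : z ∈ arc e) : z = pt cur ∨ (z = pt d ∧ d ∈ vis) := by
  rcases P.mem_imp z hz with h | ⟨e', he', hze'⟩
  · exact Or.inl h
  · obtain ⟨c, hc, hc', rfl⟩ := R.inter e he e' (P.used_mem e' he')
      (by rintro rfl; exact hu he') z hze hze'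
    have hcv : c ∈ vis := by
      rcases hc' with rfl | rfl
      exacts [(P.ends_mem e' he').1, (P.ends_mem e' he').2]
    rcases hends c hc with rfl | rfl
    exacts [Or.inl rfl, Or.inr ⟨rfl, hcv⟩]

/-- Closing up a path to a lasso. -/
theorem exists_arc (R : Realizes es pt arc X) (P : IsSweptPath es pt arc w cur vis used S)
    (he : e ∈ es) (hu : e ∉ used) (hends : ∀ c, (c = e.2.1 ∨ c = e.2.2) → c = cur ∨ c = d)
    (hA : IsArcFromTo (pt cur) (pt d) (arc e)) (hd : d ∈ vis) (F : Finset Y) :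
    ∃ y' S', IsArcFromTo w y' S' ∧ ∀ p ∈ F, ∀ e' ∈ e :: used, p ∈ arc e' → p ∈ S' := by
  obtain ⟨y', T, hT, hsub, hnot, hF⟩ := hA.exists_shorten F
  refine ⟨y', S ∪ T, P.trans hT ?_, ?_⟩
  · intro p hp hpT
    rcases P.inter_arc R he hu hends hp (hsub hpT) with h | ⟨rfl, -⟩
    · exact h
    · exact absurd hpT hnot
  · intro p hp e' he' hpe
    rcases List.mem_cons.1 he' with rfl | he'
    · by_cases hpd : p = pt d
      · exact Or.inl (hpd ▸ P.pt_mem d hd)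
      · exact Or.inr (hF p hp hpe hpd)
    · exact Or.inl (P.arc_subset e' he' hpe)

/-- Extending a path by an edge to a new vertex. -/
theorem cons (R : Realizes es pt arc X) (P : IsSweptPath es pt arc w cur vis used S)
    (he : e ∈ es) (hu : e ∉ used) (hends : ∀ c, (c = e.2.1 ∨ c = e.2.2) → c = cur ∨ c = d)
    (hA : IsArcFromTo (pt cur) (pt d) (arc e)) (hd : d ∉ vis) :
    IsSweptPath es pt arc w d (d :: vis) (e :: used) (S ∪ arc e) where
  isArc := Or.inr <| P.trans hA fun _ hp hpe =>
    (P.inter_arc R he hu hends hp hpe).resolve_right fun h => hd h.2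
  used_mem := List.forall_mem_cons.2 ⟨he, P.used_mem⟩
  arc_subset := List.forall_mem_cons.2 ⟨Set.subset_union_right,
    fun e' he' => (P.arc_subset e' he').trans Set.subset_union_left⟩
  mem_imp := by
    rintro z (hz | hz)
    · rcases P.mem_imp z hz with rfl | ⟨e', he', hz'⟩
      · exact Or.inr ⟨e, List.mem_cons_self, hA.left_mem⟩
      · exact Or.inr ⟨e', List.mem_cons_of_mem _ he', hz'⟩
    · exact Or.inr ⟨e, List.mem_cons_self, hz⟩
  ends_mem := by
    have key : ∀ c, (c = e.2.1 ∨ c = e.2.2) → c ∈ d :: vis := fun c hc => by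
      rcases hends c hc with rfl | rfl
      exacts [List.mem_cons_of_mem _ P.cur_mem, List.mem_cons_self]
    exact List.forall_mem_cons.2 ⟨⟨key _ (Or.inl rfl), key _ (Or.inr rfl)⟩, fun e' he' =>
      ⟨List.mem_cons_of_mem _ (P.ends_mem e' he').1, List.mem_cons_of_mem _ (P.ends_mem e' he').2⟩⟩
  pt_mem := List.forall_mem_cons.2 ⟨Or.inr hA.right_mem, fun c hc => Or.inl (P.pt_mem c hc)⟩
  cur_mem := List.mem_cons_self

theorem exists_arc_of_mem_lassos (R : Realizes es pt arc X) (F : Finset Y) (n : ℕ) :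
    ∀ {cur vis used S}, IsSweptPath es pt arc w cur vis used S → ∀ L ∈ lassos es n cur vis used,
      ∃ y' S', IsArcFromTo w y' S' ∧ ∀ p ∈ F, ∀ e ∈ L, p ∈ arc e → p ∈ S' := by
  induction n with
  | zero => intro _ _ _ _ _ L hL; simp [lassos] at hL
  | succ n ih =>
    intro cur vis used S P L hL
    rw [lassos, List.mem_flatMap] at hL
    obtain ⟨e, he, hL⟩ := hL
    by_cases hu : e ∈ used
    · simp [hu] at hL
    rw [if_neg hu] at hL
    have step : ∀ d, IsArcFromTo (pt cur) (pt d) (arc e) →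
        (∀ c, (c = e.2.1 ∨ c = e.2.2) → c = cur ∨ c = d) →
        L ∈ (if d ∈ vis then [e :: used] else lassos es n d (d :: vis) (e :: used)) →
        ∃ y' S', IsArcFromTo w y' S' ∧ ∀ p ∈ F, ∀ e ∈ L, p ∈ arc e → p ∈ S' := by
      intro d hA hends hL
      split_ifs at hL with hd
      · rw [List.mem_singleton] at hL
        subst hL
        exact P.exists_arc R he hu hends hA hd F
      · exact ih (P.cons R he hu hends hA hd) L hL
    rcases List.mem_append.1 hL with hL' | hL'
    · obtain ⟨rfl, hm⟩ := List.mem_ite_nil_right.1 hL'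
      exact step _ (R.isArc e he) (fun _ => id) hm
    · obtain ⟨rfl, hm⟩ := List.mem_ite_nil_right.1 hL'
      exact step _ (R.isArc e he).symm (fun _ => Or.symm) hm

end IsSweptPath

namespace Realizes

variable {Y : Type*} [TopologicalSpace Y] {es : List LabelledEdge} {pt : ℕ → Y}
  {arc : LabelledEdge → Set Y} {X : Set Y}

/-- Pulling a realization back along an embedding. -/
theorem pullback {Z : Type*} [TopologicalSpace Z] [Nonempty Z] {h : Z → Y} (hh : IsEmbedding h)
    (hr : Set.range h = X) (R : Realizes es pt arc X) :
    ∃ pt' : ℕ → Z, Realizes es pt' (fun e => h ⁻¹' arc e) Set.univ := by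
  have hsub : ∀ e ∈ es, arc e ⊆ Set.range h := fun e he z hz => hr ▸ (R.cover z).2 ⟨e, he, hz⟩
  have hpt : ∀ e ∈ es, ∀ c, (c = e.2.1 ∨ c = e.2.2) → h (Function.invFun h (pt c)) = pt c := by
    rintro e he c hc
    apply Function.invFun_eq
    rcases hc with rfl | rfl
    exacts [hsub e he (R.isArc e he).left_mem, hsub e he (R.isArc e he).right_mem]
  refine ⟨fun c => Function.invFun h (pt c), fun e he => ?_, ?_, ?_⟩
  · refine IsArcFromTo.preimage hh ?_ (hsub e he)
    rw [hpt e he _ (Or.inl rfl), hpt e he _ (Or.inr rfl)]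
    exact R.isArc e he
  · intro e he e' he' hne z hz hz'
    obtain ⟨c, hc, hc', hzc⟩ := R.inter e he e' he' hne _ hz hz'
    exact ⟨c, hc, hc', hh.injective (by rw [hpt e he c hc, hzc])⟩
  · intro z
    simpa using (R.cover (h z)).1 (hr ▸ ⟨z, rfl⟩)

theorem exists_arc_of_lassoConn (R : Realizes es pt arc X) {v : ℕ} (hv : LassoConn es v)
    {x₀ x₁ x₂ : Y} (h₀ : x₀ ∈ X) (h₁ : x₁ ∈ X) (h₂ : x₂ ∈ X) :
    ∃ y S, IsArcFromTo (pt v) y S ∧ x₀ ∈ S ∧ x₁ ∈ S ∧ x₂ ∈ S := by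
  classical
  obtain ⟨e₀, he₀, h₀⟩ := (R.cover _).1 h₀
  obtain ⟨e₁, he₁, h₁⟩ := (R.cover _).1 h₁
  obtain ⟨e₂, he₂, h₂⟩ := (R.cover _).1 h₂
  obtain ⟨L, hL, hL₀, hL₁, hL₂⟩ := hv e₀ he₀ e₁ he₁ e₂ he₂
  have P : IsSweptPath es pt arc (pt v) v [v] [] {pt v} :=
    ⟨Or.inl ⟨rfl, rfl⟩, by simp, by simp, by simp, by simp, by simp, by simp⟩
  obtain ⟨y, S, hS, hF⟩ := P.exists_arc_of_mem_lassos R {x₀, x₁, x₂} 10 L hL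
  exact ⟨y, S, hS, hF _ (by simp) _ hL₀ h₀, hF _ (by simp) _ hL₁ h₁, hF _ (by simp) _ hL₂ h₂⟩

/-- A branch vertex has no neighbourhood which embeds in the line. -/
theorem not_isBranch (R : Realizes es pt arc X) {c : ℕ} {φ : Y → ℝ} {U : Set Y}
    (hU : U ∈ 𝓝 (pt c)) (hφ : ContinuousOn φ U) (hinj : Set.InjOn φ U) : ¬ IsBranch es c := by
  rintro ⟨e₀, he₀, e₁, he₁, e₂, he₂, h01, h02, h12, hc₀, hc₁, hc₂⟩
  have key : ∀ e ∈ es, (c = e.2.1 ∨ c = e.2.2) → ∃ y, IsArcFromTo (pt c) y (arc e) ∧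
      ∀ z, z ≠ pt c → z ≠ y → ∀ c', (c' = e.2.1 ∨ c' = e.2.2) → z ≠ pt c' := by
    rintro e he (rfl | rfl)
    · refine ⟨_, R.isArc e he, ?_⟩
      rintro z h1 h2 c' (rfl | rfl)
      exacts [h1, h2]
    · refine ⟨_, (R.isArc e he).symm, ?_⟩
      rintro z h1 h2 c' (rfl | rfl)
      exacts [h2, h1]
  have hE : ∀ i, ![e₀, e₁, e₂] i ∈ es := by
    intro i; fin_cases i <;> assumption
  have hcE : ∀ i, c = (![e₀, e₁, e₂] i).2.1 ∨ c = (![e₀, e₁, e₂] i).2.2 := by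
    intro i; fin_cases i <;> assumption
  have hne : ∀ i j, i ≠ j → ![e₀, e₁, e₂] i ≠ ![e₀, e₁, e₂] j := by
    intro i j hij
    fin_cases i <;> fin_cases j <;> first | exact absurd rfl hij | assumption | exact Ne.symm ‹_›
  choose f hf hf' using fun i => key _ (hE i) (hcE i)
  obtain ⟨i, j, hij, z, hz, hz', hzc, hzf⟩ :=
    IsArcFromTo.exists_inter_of_three hf hU hφ hinj
  obtain ⟨c', hc', -, hzc'⟩ := R.inter _ (hE i) _ (hE j) (hne i j hij) z hz hz'
  exact hf' i z hzc hzf c' hc' hzc'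

/-- Subdividing an edge at an interior point. -/
theorem subdivide (R : Realizes es pt arc X)
    (hlt : ∀ e ∈ es, e.1 < 100 ∧ e.2.1 < 100 ∧ e.2.2 < 100) {e : LabelledEdge} (he : e ∈ es)
    {w : Y} (hw : w ∈ arc e) (h1 : w ≠ pt e.2.1) (h2 : w ≠ pt e.2.2) :
    ∃ arc', Realizes (subdivideEdge es e) (Function.update pt 100 w) arc' X := by
  obtain ⟨S₁, S₂, hS₁, hS₂, hS, hS'⟩ := (R.isArc e he).exists_split hw h1 h2
  have hpt : ∀ c < 100, Function.update pt 100 w c = pt c := fun c hc =>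
    Function.update_of_ne hc.ne _ _
  have hs1 := hpt _ (hlt e he).2.1
  have hs2 := hpt _ (hlt e he).2.2
  have hww : Function.update pt 100 w 100 = w := Function.update_self ..
  let arc' : LabelledEdge → Set Y := fun e => if e.1 = 100 then S₁ else if e.1 = 101 then S₂
    else arc e
  have ha1 : ∀ a, arc' (100, a) = S₁ := fun a => by simp [arc']
  have ha2 : ∀ a, arc' (101, a) = S₂ := fun a => by simp [arc']
  have ha3 : ∀ e ∈ es, arc' e = arc e := fun e he => by
    have := (hlt e he).1
    simp only [arc']
    rw [if_neg (by omega), if_neg (by omega)]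
  have hmem : ∀ e', e' ∈ subdivideEdge es e ↔
      e' = (100, e.2.1, 100) ∨ e' = (101, 100, e.2.2) ∨ (e' ∈ es ∧ e' ≠ e) := by
    intro e'
    simp [subdivideEdge]
  have hsub1 : S₁ ⊆ arc e := hS ▸ Set.subset_union_left
  have hsub2 : S₂ ⊆ arc e := hS ▸ Set.subset_union_right
  have hsrc : pt e.2.1 ∉ S₂ := fun h => h1 (hS' _ hS₁.left_mem h).symm
  have htgt : pt e.2.2 ∉ S₁ := fun h => h2 (hS' _ h hS₂.right_mem).symm
  have old : ∀ e' ∈ es, e' ≠ e → ∀ z ∈ arc e, z ∈ arc e' →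
      ∃ c < 100, (c = e.2.1 ∨ c = e.2.2) ∧ (c = e'.2.1 ∨ c = e'.2.2) ∧ z = pt c := by
    intro e' he' hne z hz hz'
    obtain ⟨c, hc, hc', hzc⟩ := R.inter e he e' he' hne.symm z hz hz'
    refine ⟨c, ?_, hc, hc', hzc⟩
    rcases hc with rfl | rfl
    exacts [(hlt e he).2.1, (hlt e he).2.2]
  have hi1 : ∀ e' ∈ es, e' ≠ e → ∀ z ∈ S₁, z ∈ arc e' →
      (e.2.1 = e'.2.1 ∨ e.2.1 = e'.2.2) ∧ z = pt e.2.1 := by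
    intro e' he' hne z hz hz'
    obtain ⟨c, -, rfl | rfl, hc', rfl⟩ := old e' he' hne z (hsub1 hz) hz'
    exacts [⟨hc', rfl⟩, absurd hz htgt]
  have hi2 : ∀ e' ∈ es, e' ≠ e → ∀ z ∈ S₂, z ∈ arc e' →
      (e.2.2 = e'.2.1 ∨ e.2.2 = e'.2.2) ∧ z = pt e.2.2 := by
    intro e' he' hne z hz hz'
    obtain ⟨c, -, rfl | rfl, hc', rfl⟩ := old e' he' hne z (hsub2 hz) hz'
    exacts [absurd hz hsrc, ⟨hc', rfl⟩]
  refine ⟨arc', ?_, ?_, ?_⟩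
  · intro e' he'
    rcases (hmem e').1 he' with rfl | rfl | ⟨he', -⟩
    · simpa only [ha1, hs1, hww] using hS₁
    · simpa only [ha2, hs2, hww] using hS₂
    · rw [ha3 e' he', hpt _ (hlt e' he').2.1, hpt _ (hlt e' he').2.2]
      exact R.isArc e' he'
  · intro e' he' e'' he'' hne z hz hz'
    rcases (hmem e').1 he' with rfl | rfl | ⟨he', hne'⟩ <;>
      rcases (hmem e'').1 he'' with rfl | rfl | ⟨he'', hne''⟩ <;>
      try simp only [ha1, ha2] at hz hz'
    · exact absurd rfl hne
    · exact ⟨100, Or.inr rfl, Or.inl rfl, by rw [hww]; exact hS' z hz hz'⟩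
    · rw [ha3 _ he''] at hz'
      obtain ⟨hc, hzc⟩ := hi1 _ he'' hne'' z hz hz'
      exact ⟨e.2.1, Or.inl rfl, hc, by rw [hs1, hzc]⟩
    · exact ⟨100, Or.inl rfl, Or.inr rfl, by rw [hww]; exact hS' z hz' hz⟩
    · exact absurd rfl hne
    · rw [ha3 _ he''] at hz'
      obtain ⟨hc, hzc⟩ := hi2 _ he'' hne'' z hz hz'
      exact ⟨e.2.2, Or.inr rfl, hc, by rw [hs2, hzc]⟩
    · rw [ha3 _ he'] at hz
      obtain ⟨hc, hzc⟩ := hi1 _ he' hne' z hz' hz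
      exact ⟨e.2.1, hc, Or.inl rfl, by rw [hs1, hzc]⟩
    · rw [ha3 _ he'] at hz
      obtain ⟨hc, hzc⟩ := hi2 _ he' hne' z hz' hz
      exact ⟨e.2.2, hc, Or.inr rfl, by rw [hs2, hzc]⟩
    · rw [ha3 _ he'] at hz
      rw [ha3 _ he''] at hz'
      obtain ⟨c, hc, hc', hzc⟩ := R.inter _ he' _ he'' hne z hz hz'
      refine ⟨c, hc, hc', ?_⟩
      rw [hpt, hzc]
      rcases hc with rfl | rfl
      exacts [(hlt _ he').2.1, (hlt _ he').2.2]
  · intro z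
    rw [R.cover]
    constructor
    · rintro ⟨e', he', hz⟩
      by_cases hee : e' = e
      · subst hee
        rw [← hS] at hz
        rcases hz with hz | hz
        · exact ⟨_, (hmem _).2 (Or.inl rfl), by rwa [ha1]⟩
        · exact ⟨_, (hmem _).2 (Or.inr (Or.inl rfl)), by rwa [ha2]⟩
      · exact ⟨e', (hmem _).2 (Or.inr (Or.inr ⟨he', hee⟩)), by rwa [ha3 e' he']⟩
    · rintro ⟨e', he', hz⟩
      rcases (hmem e').1 he' with rfl | rfl | ⟨he', -⟩
      · rw [ha1] at hz
        exact ⟨e, he, hsub1 hz⟩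
      · rw [ha2] at hz
        exact ⟨e, he, hsub2 hz⟩
      · rw [ha3 e' he'] at hz
        exact ⟨e', he', hz⟩

/-- In a realization of an admissible multigraph, a point with a neighbourhood embeddable in
the line is an endpoint of an arc through any three given points. -/
theorem exists_arc (R : Realizes es pt arc X) (hes : Admissible es) {w : Y} (hw : w ∈ X)
    {φ : Y → ℝ} {U : Set Y} (hU : U ∈ 𝓝 w) (hφ : ContinuousOn φ U) (hinj : Set.InjOn φ U)
    {x₀ x₁ x₂ : Y} (h₀ : x₀ ∈ X) (h₁ : x₁ ∈ X) (h₂ : x₂ ∈ X) :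
    ∃ y S, IsArcFromTo w y S ∧ x₀ ∈ S ∧ x₁ ∈ S ∧ x₂ ∈ S := by
  obtain ⟨e, he, hwe⟩ := (R.cover w).1 hw
  by_cases h1 : w = pt e.2.1
  · subst h1
    exact R.exists_arc_of_lassoConn ((hes.src e he).resolve_left (R.not_isBranch hU hφ hinj))
      h₀ h₁ h₂
  by_cases h2 : w = pt e.2.2
  · subst h2
    exact R.exists_arc_of_lassoConn ((hes.tgt e he).resolve_left (R.not_isBranch hU hφ hinj))
      h₀ h₁ h₂
  obtain ⟨arc', R'⟩ := R.subdivide hes.lt he hwe h1 h2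
  simpa using R'.exists_arc_of_lassoConn (hes.edge e he) h₀ h₁ h₂

end Realizes

/-- The part of the upper half circle with centre `(h, 0)` and radius `r` over `[a, b]`. -/
def upperArc (h r a b : ℝ) : Set (ℝ × ℝ) :=
  {p | a ≤ p.1 ∧ p.1 ≤ b ∧ (p.1 - h) ^ 2 + p.2 ^ 2 = r ^ 2 ∧ 0 ≤ p.2}

/-- The part of the lower half circle with centre `(h, 0)` and radius `r` over `[a, b]`. -/
def lowerArc (h r a b : ℝ) : Set (ℝ × ℝ) :=
  {p | a ≤ p.1 ∧ p.1 ≤ b ∧ (p.1 - h) ^ 2 + p.2 ^ 2 = r ^ 2 ∧ p.2 ≤ 0}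

theorem isArcFromTo_hSeg {y a b : ℝ} (hab : a < b) :
    IsArcFromTo (a, y) (b, y) (hSeg y a b) := by
  convert IsArcFromTo.of_graph hab (f := fun _ => y) continuous_const using 1
  ext p
  change (p.2 = y ∧ a ≤ p.1 ∧ p.1 ≤ b) ↔ (a ≤ p.1 ∧ p.1 ≤ b ∧ p.2 = y)
  tauto

theorem isArcFromTo_upperArc {h r a b c d : ℝ} (hab : a < b) (ha : h - r ≤ a) (hb : b ≤ h + r)
    (hc : 0 ≤ c) (hd : 0 ≤ d) (hac : (a - h) ^ 2 + c ^ 2 = r ^ 2)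
    (hbd : (b - h) ^ 2 + d ^ 2 = r ^ 2) :
    IsArcFromTo (a, c) (b, d) (upperArc h r a b) := by
  convert IsArcFromTo.of_graph hab (f := fun x => √(r ^ 2 - (x - h) ^ 2)) (by fun_prop) using 2
  · rw [← hac, add_sub_cancel_left, Real.sqrt_sq hc]
  · rw [← hbd, add_sub_cancel_left, Real.sqrt_sq hd]
  · ext ⟨x, y⟩
    refine and_congr_right fun h1 => and_congr_right fun h2 => ?_
    simp only at h1 h2
    constructor
    · rintro ⟨h3, h4⟩
      simp only at h3 h4 ⊢
      rw [← h3, add_sub_cancel_left, Real.sqrt_sq h4]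
    · intro h3
      simp only at h3 ⊢
      subst h3
      refine ⟨?_, Real.sqrt_nonneg _⟩
      rw [Real.sq_sqrt (by nlinarith)]
      ring

theorem isArcFromTo_lowerArc {h r a b c d : ℝ} (hab : a < b) (ha : h - r ≤ a) (hb : b ≤ h + r)
    (hc : c ≤ 0) (hd : d ≤ 0) (hac : (a - h) ^ 2 + c ^ 2 = r ^ 2)
    (hbd : (b - h) ^ 2 + d ^ 2 = r ^ 2) :
    IsArcFromTo (a, c) (b, d) (lowerArc h r a b) := by
  have key := isArcFromTo_upperArc (c := -c) (d := -d) hab ha hb (by linarith) (by linarith)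
    (by linarith [neg_sq c]) (by linarith [neg_sq d])
  let N : ℝ × ℝ ≃ₜ ℝ × ℝ := (Homeomorph.refl ℝ).prodCongr (Homeomorph.neg ℝ)
  have h1 := IsArcFromTo.preimage (h := N) N.isEmbedding (x := (a, c)) (y := (b, d)) key
    (by rw [N.surjective.range_eq]; exact Set.subset_univ _)
  convert h1 using 1
  ext ⟨x, y⟩
  simp [N, lowerArc, upperArc]

theorem isArcFromTo_upperHalf {h r a b : ℝ} (hr : 0 < r) (ha : a = h - r) (hb : b = h + r) :
    IsArcFromTo (a, 0) (b, 0) (upperArc h r (h - r) (h + r)) := by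
  subst ha hb
  exact isArcFromTo_upperArc (by linarith) le_rfl le_rfl le_rfl le_rfl (by ring) (by ring)

theorem isArcFromTo_lowerHalf {h r a b : ℝ} (hr : 0 < r) (ha : a = h - r) (hb : b = h + r) :
    IsArcFromTo (a, 0) (b, 0) (lowerArc h r (h - r) (h + r)) := by
  subst ha hb
  exact isArcFromTo_lowerArc (by linarith) le_rfl le_rfl le_rfl le_rfl (by ring) (by ring)

theorem mem_circleAt_iff {h r : ℝ} (hr : 0 ≤ r) (p : ℝ × ℝ) :
    p ∈ circleAt (h, 0) r ↔
      p ∈ upperArc h r (h - r) (h + r) ∨ p ∈ lowerArc h r (h - r) (h + r) := by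
  simp only [circleAt, upperArc, lowerArc, Set.mem_ofPred_eq, sub_zero]
  constructor
  · intro hp
    have := abs_le_of_sq_le_sq' (show (p.1 - h) ^ 2 ≤ r ^ 2 by nlinarith [sq_nonneg p.2]) hr
    rcases le_total 0 p.2 with h2 | h2
    · exact Or.inl ⟨by linarith, by linarith, hp, h2⟩
    · exact Or.inr ⟨by linarith, by linarith, hp, h2⟩
  · rintro (h | h)
    exacts [h.2.2.1, h.2.2.1]

theorem mem_upperArc_inter_lowerArc {h r : ℝ} {p : ℝ × ℝ}
    (h1 : p ∈ upperArc h r (h - r) (h + r)) (h2 : p ∈ lowerArc h r (h - r) (h + r)) :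
    p = (h - r, 0) ∨ p = (h + r, 0) := by
  obtain ⟨x, y⟩ := p
  obtain ⟨-, -, h3, h4⟩ := h1
  obtain ⟨-, -, -, h5⟩ := h2
  have hy : y = 0 := le_antisymm h5 h4
  subst hy
  have : (x - (h - r)) * (x - (h + r)) = 0 := by
    simp only at h3
    linear_combination h3
  rcases mul_eq_zero.1 this with h | h
  · exact Or.inl (Prod.ext (by simpa using sub_eq_zero.1 h) rfl)
  · exact Or.inr (Prod.ext (by simpa using sub_eq_zero.1 h) rfl)

/-- It suffices to check intersections of arcs on unordered pairs of edges. -/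
theorem Realizes.of_pairwise {Y : Type*} [TopologicalSpace Y] {es : List LabelledEdge}
    {pt : ℕ → Y} {arc : LabelledEdge → Set Y} {X : Set Y}
    (isArc : ∀ e ∈ es, IsArcFromTo (pt e.2.1) (pt e.2.2) (arc e))
    (inter : es.Pairwise fun e e' => ∀ z ∈ arc e, z ∈ arc e' →
      ∃ c, (c = e.2.1 ∨ c = e.2.2) ∧ (c = e'.2.1 ∨ c = e'.2.2) ∧ z = pt c)
    (cover : ∀ z, z ∈ X ↔ ∃ e ∈ es, z ∈ arc e) : Realizes es pt arc X := by
  refine ⟨isArc, ?_, cover⟩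
  intro e he e' he' hne
  have : Std.Symm fun e e' : LabelledEdge => ∀ z ∈ arc e, z ∈ arc e' →
      ∃ c, (c = e.2.1 ∨ c = e.2.2) ∧ (c = e'.2.1 ∨ c = e'.2.2) ∧ z = pt c :=
    ⟨fun e e' h z hz hz' => by
      obtain ⟨c, h1, h2, h3⟩ := h z hz' hz
      exact ⟨c, h2, h1, h3⟩⟩
  exact inter.forall he he' hne

theorem exists_realizes_unitCircleSet : ∃ es pt arc, Admissible es ∧
    Realizes es pt arc unitCircleSet := by
  refine ⟨[(0, 0, 1), (1, 0, 1)], fun c => [(-1, 0), (1, 0)].getD c 0,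
    fun e => [upperArc 0 1 (0 - 1) (0 + 1), lowerArc 0 1 (0 - 1) (0 + 1)].getD e.1 ∅, ?_,
    .of_pairwise ?_ ?_ ?_⟩
  · constructor <;> decide +kernel
  · simp only [List.forall_mem_cons, List.getD_cons_zero, List.getD_cons_succ]
    refine ⟨isArcFromTo_upperHalf ?_ ?_ ?_, isArcFromTo_lowerHalf ?_ ?_ ?_,
      by simp⟩ <;> norm_num
  · simp only [List.pairwise_cons, List.forall_mem_cons]
    refine ⟨⟨fun z hz hz' => ?_, by simp⟩, by simp, by simp⟩
    rcases mem_upperArc_inter_lowerArc hz hz' with rfl | rfl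
    exacts [⟨0, by simp⟩, ⟨1, by simp⟩]
  · intro z
    have : z ∈ unitCircleSet ↔ z ∈ circleAt (0, 0) 1 := by simp [unitCircleSet, circleAt]
    rw [this, mem_circleAt_iff zero_le_one]
    simp

theorem exists_realizes_thetaSet : ∃ es pt arc, Admissible es ∧
    Realizes es pt arc thetaSet := by
  refine ⟨[(0, 0, 1), (1, 0, 1), (2, 0, 1)], fun c => [(-1, 0), (1, 0)].getD c 0,
    fun e => [upperArc 0 1 (0 - 1) (0 + 1), lowerArc 0 1 (0 - 1) (0 + 1), hSeg 0 (-1) 1].getD e.1 ∅,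
    ?_, .of_pairwise ?_ ?_ ?_⟩
  · constructor <;> decide +kernel
  · simp only [List.forall_mem_cons, List.getD_cons_zero, List.getD_cons_succ]
    refine ⟨isArcFromTo_upperHalf ?_ ?_ ?_, isArcFromTo_lowerHalf ?_ ?_ ?_,
      isArcFromTo_hSeg ?_, by simp⟩ <;> norm_num
  · simp only [List.pairwise_cons, List.forall_mem_cons]
    refine ⟨⟨fun z hz hz' => ?_, fun z hz hz' => ?_, by simp⟩, ⟨fun z hz hz' => ?_, by simp⟩,
      by simp, by simp⟩
    · rcases mem_upperArc_inter_lowerArc hz hz' with rfl | rfl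
      exacts [⟨0, by simp⟩, ⟨1, by simp⟩]
    · have hz2 : z ∈ lowerArc 0 1 (0 - 1) (0 + 1) := ⟨hz.1, hz.2.1, hz.2.2.1, hz'.1.le⟩
      rcases mem_upperArc_inter_lowerArc hz hz2 with rfl | rfl
      exacts [⟨0, by simp⟩, ⟨1, by simp⟩]
    · have hz2 : z ∈ upperArc 0 1 (0 - 1) (0 + 1) := ⟨hz.1, hz.2.1, hz.2.2.1, hz'.1.ge⟩
      rcases mem_upperArc_inter_lowerArc hz2 hz with rfl | rfl
      exacts [⟨0, by simp⟩, ⟨1, by simp⟩]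
  · intro z
    rw [thetaSet, Set.mem_union, mem_circleAt_iff zero_le_one]
    simp [or_assoc]

theorem exists_realizes_happyFaceSet : ∃ es pt arc, Admissible es ∧
    Realizes es pt arc happyFaceSet := by
  refine ⟨[(0, 0, 1), (1, 0, 1), (2, 1, 2), (3, 1, 2), (4, 0, 2)],
    fun c => [(-2, 0), (0, 0), (2, 0)].getD c 0,
    fun e => [upperArc (-1) 1 (-1 - 1) (-1 + 1), lowerArc (-1) 1 (-1 - 1) (-1 + 1),
      upperArc 1 1 (1 - 1) (1 + 1), lowerArc 1 1 (1 - 1) (1 + 1),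
      lowerArc 0 2 (0 - 2) (0 + 2)].getD e.1 ∅,
    ?_, .of_pairwise ?_ ?_ ?_⟩
  · constructor <;> decide +kernel
  · simp only [List.forall_mem_cons, List.getD_cons_zero, List.getD_cons_succ]
    refine ⟨isArcFromTo_upperHalf ?_ ?_ ?_, isArcFromTo_lowerHalf ?_ ?_ ?_,
      isArcFromTo_upperHalf ?_ ?_ ?_, isArcFromTo_lowerHalf ?_ ?_ ?_,
      isArcFromTo_lowerHalf ?_ ?_ ?_, by simp⟩ <;> norm_num
  · have left : ∀ z : ℝ × ℝ, (z.1 - -1) ^ 2 + z.2 ^ 2 = 1 ^ 2 → (z.1 - 0) ^ 2 + z.2 ^ 2 = 2 ^ 2 →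
        z = (-2, 0) := by
      rintro ⟨x, y⟩ h1 h2
      simp only at h1 h2
      obtain rfl : x = -2 := by linarith
      obtain rfl : y = 0 := by nlinarith
      rfl
    have right : ∀ z : ℝ × ℝ, (z.1 - 1) ^ 2 + z.2 ^ 2 = 1 ^ 2 → (z.1 - 0) ^ 2 + z.2 ^ 2 = 2 ^ 2 →
        z = (2, 0) := by
      rintro ⟨x, y⟩ h1 h2
      simp only at h1 h2
      obtain rfl : x = 2 := by linarith
      obtain rfl : y = 0 := by nlinarith
      rfl
    have mid : ∀ z : ℝ × ℝ, (z.1 - -1) ^ 2 + z.2 ^ 2 = 1 ^ 2 → (z.1 - 1) ^ 2 + z.2 ^ 2 = 1 ^ 2 →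
        z = (0, 0) := by
      rintro ⟨x, y⟩ h1 h2
      simp only at h1 h2
      obtain rfl : x = 0 := by linarith
      obtain rfl : y = 0 := by nlinarith
      rfl
    simp only [List.pairwise_cons, List.forall_mem_cons]
    refine ⟨⟨fun z hz hz' => ?_, fun z hz hz' => ⟨1, ?_, ?_, mid z hz.2.2.1 hz'.2.2.1⟩,
      fun z hz hz' => ⟨1, ?_, ?_, mid z hz.2.2.1 hz'.2.2.1⟩,
      fun z hz hz' => ⟨0, ?_, ?_, left z hz.2.2.1 hz'.2.2.1⟩, by simp⟩,
      ⟨fun z hz hz' => ⟨1, ?_, ?_, mid z hz.2.2.1 hz'.2.2.1⟩,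
      fun z hz hz' => ⟨1, ?_, ?_, mid z hz.2.2.1 hz'.2.2.1⟩,
      fun z hz hz' => ⟨0, ?_, ?_, left z hz.2.2.1 hz'.2.2.1⟩, by simp⟩,
      ⟨fun z hz hz' => ?_, fun z hz hz' => ⟨2, ?_, ?_, right z hz.2.2.1 hz'.2.2.1⟩, by simp⟩,
      ⟨fun z hz hz' => ⟨2, ?_, ?_, right z hz.2.2.1 hz'.2.2.1⟩, by simp⟩, by simp, by simp⟩
    case refine_1 =>
      rcases mem_upperArc_inter_lowerArc hz hz' with rfl | rfl
      exacts [⟨0, by norm_num⟩, ⟨1, by norm_num⟩]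
    case refine_14 =>
      rcases mem_upperArc_inter_lowerArc hz hz' with rfl | rfl
      exacts [⟨1, by norm_num⟩, ⟨2, by norm_num⟩]
    all_goals simp
  · intro z
    have h3 : z.1 ^ 2 + z.2 ^ 2 = 4 ∧ z.2 ≤ 0 ↔ z ∈ lowerArc 0 2 (0 - 2) (0 + 2) := by
      constructor
      · rintro ⟨h1, h2⟩
        exact ⟨by nlinarith [sq_nonneg z.2], by nlinarith [sq_nonneg z.2], by linarith, h2⟩
      · rintro ⟨-, -, h1, h2⟩
        exact ⟨by linarith, h2⟩
    rw [happyFaceSet, Set.mem_union, Set.mem_union, mem_circleAt_iff zero_le_one,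
      mem_circleAt_iff zero_le_one]
    change _ ∨ (z.1 ^ 2 + z.2 ^ 2 = 4 ∧ z.2 ≤ 0) ↔ _
    rw [h3]
    simp [or_assoc]

theorem upperArc_union {h r a b c : ℝ} (hab : a ≤ b) (hbc : b ≤ c) :
    upperArc h r a b ∪ upperArc h r b c = upperArc h r a c := by
  ext p
  constructor
  · rintro (⟨h1, h2, h3⟩ | ⟨h1, h2, h3⟩)
    exacts [⟨h1, h2.trans hbc, h3⟩, ⟨hab.trans h1, h2, h3⟩]
  · rintro ⟨h1, h2, h3⟩
    rcases le_total p.1 b with h | h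
    exacts [Or.inl ⟨h1, h, h3⟩, Or.inr ⟨h, h2, h3⟩]

theorem exists_realizes_baguetteSet : ∃ es pt arc, Admissible es ∧
    Realizes es pt arc baguetteSet := by
  refine ⟨[(0, 0, 1), (1, 1, 2), (2, 0, 2), (3, 3, 4), (4, 4, 5), (5, 3, 5), (6, 2, 3), (7, 1, 4)],
    fun c => [(-4, 0), (-3, 1), (-2, 0), (2, 0), (3, 1), (4, 0)].getD c 0,
    fun e => [upperArc (-3) 1 (-4) (-3), upperArc (-3) 1 (-3) (-2), lowerArc (-3) 1 (-4) (-2),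
      upperArc 3 1 2 3, upperArc 3 1 3 4, lowerArc 3 1 2 4,
      hSeg 0 (-2) 2, hSeg 1 (-3) 3].getD e.1 ∅,
    ?_, .of_pairwise ?_ ?_ ?_⟩
  · constructor <;> decide +kernel
  · simp only [List.forall_mem_cons, List.getD_cons_zero, List.getD_cons_succ]
    refine ⟨isArcFromTo_upperArc ?_ ?_ ?_ ?_ ?_ ?_ ?_, isArcFromTo_upperArc ?_ ?_ ?_ ?_ ?_ ?_ ?_,
      isArcFromTo_lowerArc ?_ ?_ ?_ ?_ ?_ ?_ ?_, isArcFromTo_upperArc ?_ ?_ ?_ ?_ ?_ ?_ ?_,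
      isArcFromTo_upperArc ?_ ?_ ?_ ?_ ?_ ?_ ?_, isArcFromTo_lowerArc ?_ ?_ ?_ ?_ ?_ ?_ ?_,
      isArcFromTo_hSeg ?_, isArcFromTo_hSeg ?_, by simp⟩ <;> norm_num
  · simp only [List.pairwise_cons, List.forall_mem_cons, List.not_mem_nil, false_implies,
      implies_true, and_true, List.Pairwise.nil]
    simp only [List.getD_cons_zero, List.getD_cons_succ, Prod.forall, upperArc, lowerArc, hSeg,
      Set.mem_ofPred_eq]
    refine ⟨⟨?_, ?_, ?_, ?_, ?_, ?_, ?_⟩, ⟨?_, ?_, ?_, ?_, ?_, ?_⟩, ⟨?_, ?_, ?_, ?_, ?_⟩,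
      ⟨?_, ?_, ?_, ?_⟩, ⟨?_, ?_, ?_⟩, ⟨?_, ?_⟩, ?_⟩
    all_goals
      intro x y hz hz'
      first
        | exfalso
          linarith
        | exact ⟨0, by decide, by decide,
            Prod.ext (show x = -4 by nlinarith) (show y = 0 by nlinarith)⟩
        | exact ⟨1, by decide, by decide,
            Prod.ext (show x = -3 by nlinarith) (show y = 1 by nlinarith)⟩
        | exact ⟨2, by decide, by decide,
            Prod.ext (show x = -2 by nlinarith) (show y = 0 by nlinarith)⟩
        | exact ⟨3, by decide, by decide,
            Prod.ext (show x = 2 by nlinarith) (show y = 0 by nlinarith)⟩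
        | exact ⟨4, by decide, by decide,
            Prod.ext (show x = 3 by nlinarith) (show y = 1 by nlinarith)⟩
        | exact ⟨5, by decide, by decide,
            Prod.ext (show x = 4 by nlinarith) (show y = 0 by nlinarith)⟩
  · intro z
    have h1 : upperArc (-3) 1 (-4) (-3) ∪ upperArc (-3) 1 (-3) (-2) =
        upperArc (-3) 1 (-3 - 1) (-3 + 1) := by
      rw [upperArc_union] <;> norm_num
    have h2 : upperArc 3 1 2 3 ∪ upperArc 3 1 3 4 = upperArc 3 1 (3 - 1) (3 + 1) := by
      rw [upperArc_union] <;> norm_num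
    have h3 : lowerArc (-3) 1 (-4) (-2) = lowerArc (-3) 1 (-3 - 1) (-3 + 1) := by norm_num
    have h4 : lowerArc 3 1 2 4 = lowerArc 3 1 (3 - 1) (3 + 1) := by norm_num
    rw [baguetteSet, Set.mem_union, Set.mem_union, Set.mem_union, mem_circleAt_iff zero_le_one,
      mem_circleAt_iff zero_le_one, ← h1, ← h2, ← h3, ← h4]
    simp [or_assoc]

/-- An interior point of an edge has a neighbourhood in `|G|` which embeds in the line. -/
theorem exists_injOn_nhds_edgePoint {V : Type*} {G : SimpleGraph V} {v u : V} (hadj : G.Adj v u)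
    {t : ℝ} (ht : t ∈ Set.Ioo (0 : ℝ) 1) (w : GraphRealization G)
    (hw : (w : V → ℝ) = edgePoint v u t) :
    ∃ (φ : GraphRealization G → ℝ) (U : Set (GraphRealization G)),
      U ∈ 𝓝 w ∧ ContinuousOn φ U ∧ Set.InjOn φ U := by
  have hvu : v ≠ u := hadj.ne
  have hc : ∀ a : V, Continuous fun x : GraphRealization G => (x : V → ℝ) a := fun a =>
    (continuous_apply a).comp continuous_subtype_val
  refine ⟨fun x => (x : V → ℝ) u, {x | 0 < (x : V → ℝ) v} ∩ {x | 0 < (x : V → ℝ) u},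
    IsOpen.mem_nhds ((isOpen_lt continuous_const (hc v)).inter (isOpen_lt continuous_const (hc u)))
      ⟨?_, ?_⟩, (hc u).continuousOn, ?_⟩
  · change 0 < (w : V → ℝ) v
    simpa [hw, edgePoint, hvu] using ht.2
  · change 0 < (w : V → ℝ) u
    simpa [hw, edgePoint, hvu.symm] using ht.1
  · have key : ∀ x ∈ GraphRealization G, 0 < x v → 0 < x u → x = edgePoint v u (x u) := by
      rintro x (⟨a, rfl⟩ | ⟨a, b, s, hab, hs, rfl⟩) hv hu
      · simp only [vertexPoint] at hv hu
        split_ifs at hv hu with h1 h2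
        · exact absurd (h1.trans h2.symm) hvu
        all_goals simp at hv hu
      · have hv' : v = a ∨ v = b := by
          by_contra! h
          simp [edgePoint, h.1, h.2] at hv
        have hu' : u = a ∨ u = b := by
          by_contra! h
          simp [edgePoint, h.1, h.2] at hu
        rcases hv' with rfl | rfl <;> rcases hu' with rfl | rfl
        · exact absurd rfl hvu
        · have : edgePoint v u s u = s := by simp [edgePoint, hvu.symm]
          rw [this]
        · have : edgePoint u v s u = 1 - s := by simp [edgePoint, hvu.symm]
          rw [this]
          ext c
          simp [edgePoint, add_comm]
        · exact absurd rfl hvu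
    rintro ⟨x, hx⟩ ⟨hxv, hxu⟩ ⟨y, hy⟩ ⟨hyv, hyu⟩ hxy
    have hxy' : x u = y u := hxy
    exact Subtype.ext ((key x hx hxv hxu).trans (hxy' ▸ (key y hy hyv hyu).symm))

theorem IsBasicFourAC.exists_realizes {V : Type*} {G : SimpleGraph V} (hG : IsBasicFourAC G)
    [Nonempty (GraphRealization G)] : ∃ es, ∃ pt : ℕ → GraphRealization G, ∃ arc,
      Admissible es ∧ Realizes es pt arc Set.univ := by
  have key : ∀ X : Set (ℝ × ℝ), Nonempty (GraphRealization G ≃ₜ X) →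
      (∃ es pt arc, Admissible es ∧ Realizes es pt arc X) →
      ∃ es, ∃ pt : ℕ → GraphRealization G, ∃ arc, Admissible es ∧ Realizes es pt arc Set.univ := by
    rintro X ⟨h⟩ ⟨es, pt, arc, hes, R⟩
    obtain ⟨pt', R'⟩ := R.pullback (h := Subtype.val ∘ h)
      (IsEmbedding.subtypeVal.comp h.isEmbedding)
      (by rw [h.surjective.range_comp, Subtype.range_coe])
    exact ⟨es, pt', _, hes, R'⟩
  rcases hG with h | h | h | h
  exacts [key _ h exists_realizes_unitCircleSet, key _ h exists_realizes_thetaSet,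
    key _ h exists_realizes_happyFaceSet, key _ h exists_realizes_baguetteSet]

/-- If `G` is a basic 4-ac graph, `w = edgePoint v u t` a point in the
interior of an edge of `|G|`, and `x₀, x₁, x₂` any three further points of `|G|`, then
there is an arc in `|G|` containing `x₀`, `x₁`, `x₂` having `w` as an endpoint. -/
theorem statement9 {V : Type*} (G : SimpleGraph V) (hG : IsBasicFourAC G)
    (v u : V) (hadj : G.Adj v u) (t : ℝ) (ht : t ∈ Set.Ioo (0 : ℝ) 1)
    (x₀ x₁ x₂ : ↥(GraphRealization G)) :
    ∃ f : ↥unitInterval → ↥(GraphRealization G), Topology.IsEmbedding f ∧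
      (f 0 : V → ℝ) = edgePoint v u t ∧
      x₀ ∈ Set.range f ∧ x₁ ∈ Set.range f ∧ x₂ ∈ Set.range f := by
  have hw : edgePoint v u t ∈ GraphRealization G :=
    Or.inr ⟨v, u, t, hadj, Set.Ioo_subset_Icc_self ht, rfl⟩
  have : Nonempty (GraphRealization G) := ⟨x₀⟩
  obtain ⟨φ, U, hU, hφ, hinj⟩ := exists_injOn_nhds_edgePoint hadj ht ⟨_, hw⟩ rfl
  obtain ⟨es, pt, arc, hes, R⟩ := hG.exists_realizes
  obtain ⟨y, S, ⟨γ, hγ, rfl⟩, h₀, h₁, h₂⟩ := R.exists_arc hes (Set.mem_univ _) hU hφ hinj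
    (Set.mem_univ x₀) (Set.mem_univ x₁) (Set.mem_univ x₂)
  exact ⟨γ, (γ.continuous.isClosedEmbedding hγ).isEmbedding, congrArg Subtype.val γ.source,
    h₀, h₁, h₂⟩
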